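/- Let K ⊂ ℝ^N be a convex body with inradius r_K and set of incenters M(K) = {x ∈ K : dist(x, ∂K) = r_K}. Then for every unit vector ω ∈ S^{N-1} and every λ ∈ ℝ, if the reflection T_{λ,ω}(K_{λ,ω}) is contained in K, then T_{λ,ω}({x ∈ M(K) : ⟨x,ω⟩ ≥ λ}) is contained in M(K); equivalently, the maximal folding function of M(K) (regarded as a compact convex subset of ℝ^N) satisfies R_{M(K)}(ω) ≤ R_K(ω) for every ω ∈ S^{N-1}. -/

import Mathlib

open MeasureTheory Set Metric
open scoped RealInnerProductSpace ENNReal NNReal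

noncomputable section

/-- Reflection of `x` across the hyperplane `{z : ⟪z, ω⟫ = l}` (for a unit vector `ω`). -/
def reflectH {N : ℕ} (l : ℝ) (ω x : EuclideanSpace ℝ (Fin N)) : EuclideanSpace ℝ (Fin N) :=
  x + (2 * (l - ⟪x, ω⟫)) • ω

/-- The maximal folding function of a set `K`:
`R_K(ω) = inf {l : the reflection of K ∩ {⟪·,ω⟫ ≥ l} across {⟪·,ω⟫ = l} lies in K}`. -/
def foldingFn {N : ℕ} (K : Set (EuclideanSpace ℝ (Fin N))) (ω : EuclideanSpace ℝ (Fin N)) : ℝ :=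
  sInf {l : ℝ | reflectH l ω '' {x ∈ K | l ≤ ⟪x, ω⟫} ⊆ K}

/-- The heart of a set `K`. -/
def heart {N : ℕ} (K : Set (EuclideanSpace ℝ (Fin N))) : Set (EuclideanSpace ℝ (Fin N)) :=
  {x ∈ K | ∀ ω : EuclideanSpace ℝ (Fin N), ‖ω‖ = 1 → ⟪x, ω⟫ ≤ foldingFn K ω}

/-- The set of incenters of `K` with inradius `r`: points of `K` at distance `r`
from the boundary of `K`. -/
def incenterSet {N : ℕ} (K : Set (EuclideanSpace ℝ (Fin N))) (r : ℝ) :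
    Set (EuclideanSpace ℝ (Fin N)) :=
  {x ∈ K | Metric.infDist x (frontier K) = r}

theorem inner_reflectH {N : ℕ} (l : ℝ) {ω : EuclideanSpace ℝ (Fin N)} (hω : ‖ω‖ = 1)
    (x : EuclideanSpace ℝ (Fin N)) : ⟪reflectH l ω x, ω⟫ = 2 * l - ⟪x, ω⟫ := by
  rw [reflectH, inner_add_left, real_inner_smul_left, real_inner_self_eq_norm_sq, hω]
  ring

theorem reflectH_reflectH {N : ℕ} (l : ℝ) {ω : EuclideanSpace ℝ (Fin N)} (hω : ‖ω‖ = 1)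
    (x : EuclideanSpace ℝ (Fin N)) : reflectH l ω (reflectH l ω x) = x := by
  rw [reflectH, inner_reflectH l hω, reflectH]
  module

theorem dist_reflectH_sq {N : ℕ} (l : ℝ) {ω : EuclideanSpace ℝ (Fin N)} (hω : ‖ω‖ = 1)
    (x y : EuclideanSpace ℝ (Fin N)) :
    dist (reflectH l ω y) x ^ 2 = dist y x ^ 2 + 4 * (l - ⟪y, ω⟫) * (l - ⟪x, ω⟫) := by
  have h : reflectH l ω y - x = (y - x) + (2 * (l - ⟪y, ω⟫)) • ω := by
    rw [reflectH]; abel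
  rw [dist_eq_norm, dist_eq_norm, h, norm_add_sq_real, real_inner_smul_right, norm_smul, hω,
    inner_sub_left, mul_one, Real.norm_eq_abs, sq_abs]
  ring

theorem ball_infDist_frontier_subset {E : Type*} [NormedAddCommGroup E] [NormedSpace ℝ E]
    {K : Set E} {x : E} (hx : x ∈ K) : ball x (infDist x (frontier K)) ⊆ K := by
  intro y hy
  by_contra hyK
  have hpos : 0 < infDist x (frontier K) := dist_nonneg.trans_lt hy
  have hfr : ∀ z ∈ ball x (infDist x (frontier K)), z ∉ frontier K := fun z hz hzK =>
    (infDist_le_dist_of_mem hzK).not_gt (mem_ball'.1 hz)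
  have hint : ∀ z ∈ ball x (infDist x (frontier K)), z ∈ closure K → z ∈ interior K :=
    fun z hz hzK => by_contra fun h => hfr z hz ⟨hzK, h⟩
  have hxb := mem_ball_self (x := x) hpos
  obtain ⟨z, -, hz, hz'⟩ := (convex_ball x (infDist x (frontier K))).isPreconnected
    (interior K) (closure K)ᶜ isOpen_interior isClosed_closure.isOpen_compl
    (fun z hz => or_iff_not_imp_right.2 fun h => hint z hz (not_not.1 h))
    ⟨x, hxb, hint x hxb (subset_closure hx)⟩
    ⟨y, hy, fun h => hyK (interior_subset (hint y hy h))⟩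
  exact hz' (subset_closure (interior_subset hz))

theorem le_infDist_frontier_of_ball_subset {E : Type*} [PseudoMetricSpace E]
    {K : Set E} {x : E} {r : ℝ} (hne : (frontier K).Nonempty) (h : ball x r ⊆ K) :
    r ≤ infDist x (frontier K) := by
  refine (le_infDist hne).2 fun y hy => ?_
  by_contra! hlt
  exact hy.2 (interior_maximal h isOpen_ball (mem_ball'.2 hlt))

theorem ball_reflectH_subset {N : ℕ} {K : Set (EuclideanSpace ℝ (Fin N))} {l r : ℝ}
    {ω x : EuclideanSpace ℝ (Fin N)} (hω : ‖ω‖ = 1)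
    (hK : reflectH l ω '' {x ∈ K | l ≤ ⟪x, ω⟫} ⊆ K) (hx : l ≤ ⟪x, ω⟫) (hball : ball x r ⊆ K) :
    ball (reflectH l ω x) r ⊆ K := by
  intro y hy
  have hyr : dist (reflectH l ω x) y < r := mem_ball'.1 hy
  have hxy := dist_reflectH_sq l hω y x
  have hyx := dist_reflectH_sq l hω x y
  rw [dist_comm y x] at hyx
  rcases le_total l ⟪y, ω⟫ with hly | hly
  · refine hball (mem_ball'.2 (lt_of_le_of_lt (abs_le_of_sq_le_sq' ?_ dist_nonneg).2 hyr))
    nlinarith [mul_nonneg (sub_nonneg.2 hx) (sub_nonneg.2 hly)]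
  · rw [← reflectH_reflectH l hω y]
    refine hK ⟨_, ⟨hball (mem_ball.2 (lt_of_le_of_lt
      (abs_le_of_sq_le_sq' ?_ dist_nonneg).2 hyr)), ?_⟩, rfl⟩
    · linarith
    · rw [inner_reflectH l hω]; linarith

theorem bddBelow_folding_levels {N : ℕ} {A : Set (EuclideanSpace ℝ (Fin N))}
    (hA : Bornology.IsBounded A) (hne : A.Nonempty) {ω : EuclideanSpace ℝ (Fin N)}
    (hω : ‖ω‖ = 1) : BddBelow {l : ℝ | reflectH l ω '' {x ∈ A | l ≤ ⟪x, ω⟫} ⊆ A} := by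
  obtain ⟨R, hR⟩ := hA.exists_norm_le
  have hin : ∀ z ∈ A, |⟪z, ω⟫| ≤ R := fun z hz => by
    simpa [hω] using (abs_real_inner_le_norm z ω).trans
      (mul_le_mul_of_nonneg_right (hR z hz) (norm_nonneg ω))
  obtain ⟨x, hx⟩ := hne
  refine ⟨-R, fun l hl => ?_⟩
  have hx' := abs_le.1 (hin x hx)
  by_contra! hlt
  have h := (abs_le.1 (hin _ (hl ⟨x, ⟨hx, by linarith⟩, rfl⟩))).1
  rw [inner_reflectH l hω] at h
  linarith

theorem nonempty_folding_levels {N : ℕ} {A : Set (EuclideanSpace ℝ (Fin N))}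
    (hA : Bornology.IsBounded A) {ω : EuclideanSpace ℝ (Fin N)} (hω : ‖ω‖ = 1) :
    {l : ℝ | reflectH l ω '' {x ∈ A | l ≤ ⟪x, ω⟫} ⊆ A}.Nonempty := by
  obtain ⟨R, hR⟩ := hA.exists_norm_le
  refine ⟨R + 1, ?_⟩
  rintro _ ⟨x, ⟨hx, hlx⟩, rfl⟩
  have h := real_inner_le_norm x ω
  rw [hω, mul_one] at h
  linarith [hR x hx]

/-- Every admissible folding of `K` maps the set of incenters into itself; equivalently
the maximal folding function of the set of incenters is at most that of `K`. -/
theorem statement8 {N : ℕ} (K : Set (EuclideanSpace ℝ (Fin N)))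
    (hKcpt : IsCompact K) (hKconv : Convex ℝ K) (hKint : (interior K).Nonempty)
    (r : ℝ) (hr₁ : ∀ x ∈ K, Metric.infDist x (frontier K) ≤ r)
    (hr₂ : ∃ x ∈ K, Metric.infDist x (frontier K) = r) :
    ∀ ω : EuclideanSpace ℝ (Fin N), ‖ω‖ = 1 →
      (∀ l : ℝ, reflectH l ω '' {x ∈ K | l ≤ ⟪x, ω⟫} ⊆ K →
        reflectH l ω '' {x ∈ incenterSet K r | l ≤ ⟪x, ω⟫} ⊆ incenterSet K r) ∧
      foldingFn (incenterSet K r) ω ≤ foldingFn K ω := by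
  intro ω hω
  have hbdd := hKcpt.isBounded
  have hfr : (frontier K).Nonempty := by
    rw [nonempty_frontier_iff]
    refine ⟨hKint.mono interior_subset, fun hK => ?_⟩
    obtain ⟨R, hR⟩ := hbdd.exists_norm_le
    have h := hR ((|R| + 1) • ω) (hK ▸ mem_univ _)
    rw [norm_smul, hω, mul_one, Real.norm_eq_abs, abs_of_pos (by positivity)] at h
    linarith [le_abs_self R]
  have key : ∀ l : ℝ, reflectH l ω '' {x ∈ K | l ≤ ⟪x, ω⟫} ⊆ K →
      reflectH l ω '' {x ∈ incenterSet K r | l ≤ ⟪x, ω⟫} ⊆ incenterSet K r := by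
    rintro l hl _ ⟨x, ⟨⟨hxK, rfl⟩, hlx⟩, rfl⟩
    have hmem : reflectH l ω x ∈ K := hl ⟨x, ⟨hxK, hlx⟩, rfl⟩
    exact ⟨hmem, (hr₁ _ hmem).antisymm (le_infDist_frontier_of_ball_subset hfr
      (ball_reflectH_subset hω hl hlx (ball_infDist_frontier_subset hxK)))⟩
  exact ⟨key, csInf_le_csInf
    (bddBelow_folding_levels (hbdd.subset (sep_subset _ _)) hr₂ hω)
    (nonempty_folding_levels hbdd hω) key⟩
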